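/- Let A ∈ M_d(ℤ) and v ∈ ℚ^d \ {0}. Let V = Span_ℝ{v, Av, …, A^{d−1}v} and suppose the restriction A|_V is non-singular. Then the sequence (A^{kn+ℓ} ω v)_{n≥0} is uniformly distributed modulo 1 in V for every integer k ≥ 1, every ℓ ∈ ℕ, and Lebesgue-almost every ω ∈ ℝ, if and only if A|_V has no two distinct eigenvalues whose ratio is a root of unity and no eigenvalue of A|_V is a root of unity. -/

import Mathlib

open MeasureTheory Filter Matrix

/-- A sequence in `ℝ^r` is uniformly distributed modulo 1 if the Birkhoff-type averages of
every continuous `ℤ^r`-periodic function converge to its integral over the torus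
(realized as the unit cube `[0,1]^r` with Lebesgue measure). -/
def UDMod1 {r : ℕ} (x : ℕ → (Fin r → ℝ)) : Prop :=
  ∀ f : (Fin r → ℝ) → ℂ, Continuous f →
    (∀ (y : Fin r → ℝ) (k : Fin r → ℤ), f (y + fun i => (k i : ℝ)) = f y) →
    Tendsto (fun N : ℕ => (N : ℂ)⁻¹ • ∑ n ∈ Finset.range N, f (x n)) atTop
      (nhds (∫ y in Set.Icc (0 : Fin r → ℝ) 1, f y))

/-- A complex number is a root of unity. -/
def IsRootOfUnity (z : ℂ) : Prop := ∃ n : ℕ, 0 < n ∧ z ^ n = 1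


lemma tendsto_padic_pow_div_factorial_mul {p : ℕ} [hp : Fact p.Prime] (hp2 : 2 < p) (w : ℕ → ℤ) :
    Tendsto (fun i : ℕ => ‖(p : ℚ_[p]) ^ i * (w i : ℚ_[p]) / (i.factorial : ℚ_[p])‖) atTop
      (nhds 0) := by
  have hp1 : (1 : ℝ) < p := by exact_mod_cast hp.out.one_lt
  have hp0 : (0 : ℝ) < p := by linarith
  have hlim : Tendsto (fun i : ℕ => (((p : ℝ)⁻¹) ^ (i / 2))) atTop (nhds 0) :=
    (tendsto_pow_atTop_nhds_zero_of_lt_one (by positivity) (inv_lt_one_of_one_lt₀ hp1)).comp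
      (Nat.tendsto_div_const_atTop (by norm_num))
  refine squeeze_zero (fun _ => norm_nonneg _) (fun i => ?_) hlim
  have hv : padicValNat p i.factorial * 2 ≤ i := by
    have h := sub_one_mul_padicValNat_factorial (p := p) i
    have h2 : 2 * padicValNat p i.factorial ≤ (p - 1) * padicValNat p i.factorial :=
      Nat.mul_le_mul_right _ (by omega)
    omega
  have hf : (i.factorial : ℚ_[p]) ≠ 0 := by exact_mod_cast i.factorial_ne_zero
  rw [norm_div, norm_mul, Padic.norm_p_pow, Padic.norm_eq_zpow_neg_valuation hf,
    Padic.valuation_natCast]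
  calc (p : ℝ) ^ (-(i : ℤ)) * ‖(w i : ℚ_[p])‖ / (p : ℝ) ^ (-(padicValNat p i.factorial : ℤ))
      ≤ (p : ℝ) ^ (-(i : ℤ)) * 1 / (p : ℝ) ^ (-(padicValNat p i.factorial : ℤ)) := by
        gcongr
        exact Padic.norm_int_le_one _
    _ = (p : ℝ) ^ (-(i : ℤ) - (-(padicValNat p i.factorial : ℤ))) := by
        rw [zpow_sub₀ hp0.ne', mul_one]
    _ ≤ (p : ℝ) ^ (-((i / 2 : ℕ) : ℤ)) := by
        apply zpow_le_zpow_right₀ hp1.le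
        omega
    _ = _ := by rw [inv_pow, _root_.zpow_neg, zpow_natCast]

lemma exists_last_max_of_tendsto_zero {e : ℕ → ℝ} (he0 : ∀ i, 0 ≤ e i)
    (he : Tendsto e atTop (nhds 0)) (hne : ∃ i, 1 ≤ i ∧ e i ≠ 0) :
    ∃ s, 1 ≤ s ∧ 0 < e s ∧ (∀ i, 1 ≤ i → e i ≤ e s) ∧ ∀ i, s < i → e i < e s := by
  obtain ⟨i0, hi0, hne⟩ := hne
  have hpos : 0 < e i0 := lt_of_le_of_ne (he0 _) (Ne.symm hne)
  obtain ⟨N, hN⟩ := eventually_atTop.1 (he.eventually (gt_mem_nhds hpos))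
  have hi0N : i0 < N := by
    by_contra h
    exact lt_irrefl _ (hN i0 (by omega))
  obtain ⟨m, hm, hmax⟩ := Finset.exists_max_image (Finset.Ico 1 N) e ⟨i0, by simp; omega⟩
  have hm0 : e i0 ≤ e m := hmax i0 (by simp; omega)
  have hglob : ∀ i, 1 ≤ i → e i ≤ e m := fun i hi => by
    by_cases h : i < N
    · exact hmax i (by simp; omega)
    · exact ((hN i (by omega)).trans_le hm0).le
  have hT : ((Finset.Ico 1 N).filter fun i => e i = e m).Nonempty :=
    ⟨m, by simpa using hm⟩
  set s := ((Finset.Ico 1 N).filter fun i => e i = e m).max' hT with hs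
  have hsm := Finset.max'_mem _ hT
  rw [← hs] at hsm
  simp only [Finset.mem_filter, Finset.mem_Ico] at hsm
  refine ⟨s, hsm.1.1, by linarith [hsm.2], fun i hi => hsm.2 ▸ hglob i hi, fun i hi => ?_⟩
  by_cases h : i < N
  · refine lt_of_le_of_ne (hsm.2 ▸ hglob i (by omega)) fun hEq => ?_
    have := Finset.le_max' _ i (show i ∈ ((Finset.Ico 1 N).filter fun i => e i = e m) by
      simp only [Finset.mem_filter, Finset.mem_Ico]
      exact ⟨by omega, hEq.trans hsm.2⟩)
    omega
  · rw [hsm.2]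
    exact (hN i (by omega)).trans_le hm0

/-- A Strassmann-type bound: a nonconstant function given by a Mahler series whose coefficients
decay `p`-adically takes each value a uniformly bounded number of times on `ℕ`. -/
lemma exists_card_le_of_sum_choose_mul_pow {p : ℕ} [hp : Fact p.Prime] (hp2 : 2 < p)
    (w : ℕ → ℤ) (hw : ∃ i, 1 ≤ i ∧ w i ≠ 0) :
    ∃ s : ℕ, ∀ (C : ℤ) (S : Finset ℕ),
      (∀ n ∈ S, ∑ i ∈ Finset.range (n + 1), (n.choose i : ℤ) * p ^ i * w i = C) →
      S.card ≤ s := by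
  classical
  set e : ℕ → ℚ_[p] := fun i => (p : ℚ_[p]) ^ i * (w i : ℚ_[p]) / (i.factorial : ℚ_[p]) with he
  have hpQ : (p : ℚ_[p]) ≠ 0 := by exact_mod_cast hp.out.ne_zero
  have hfac : ∀ i : ℕ, (i.factorial : ℚ_[p]) ≠ 0 := fun i => by
    exact_mod_cast i.factorial_ne_zero
  obtain ⟨s, hs1, hs0, hsmax, hslast⟩ := exists_last_max_of_tendsto_zero
    (e := fun i => ‖e i‖) (fun _ => norm_nonneg _) (tendsto_padic_pow_div_factorial_mul hp2 w) (by
      obtain ⟨i, hi, hwi⟩ := hw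
      refine ⟨i, hi, ?_⟩
      rw [norm_ne_zero_iff]
      exact div_ne_zero (mul_ne_zero (pow_ne_zero _ hpQ) (by exact_mod_cast hwi)) (hfac i))
  have hes : e s ≠ 0 := norm_pos_iff.1 hs0
  have ha : ∀ i, ‖if i = 0 then 0 else e i / e s‖ ≤ 1 := fun i => by
    split_ifs with h
    · simp
    · rw [norm_div]
      exact (div_le_one hs0).2 (hsmax i (by omega))
  set a : ℕ → ℤ_[p] := fun i => ⟨if i = 0 then 0 else e i / e s, ha i⟩ with hadef
  have ha0 : a 0 = 0 := Subtype.ext (by simp [hadef])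
  have has : a s = 1 := Subtype.ext (by simp [hadef, hes, show s ≠ 0 by omega])
  have hacoe : ∀ i, 1 ≤ i → (a i : ℚ_[p]) = e i / e s := fun i hi => by
    simp [hadef, show i ≠ 0 by omega]
  have hagt : ∀ i, s < i → PadicInt.toZMod (a i) = 0 := fun i hi => by
    rw [← RingHom.mem_ker, PadicInt.ker_toZMod, IsLocalRing.mem_maximalIdeal, PadicInt.mem_nonunits,
      PadicInt.norm_def, hacoe i (by omega), norm_div]
    exact (div_lt_one hs0).2 (hslast i hi)
  refine ⟨s, fun C S hS => ?_⟩
  rcases S.eq_empty_or_nonempty with rfl | ⟨n₀, hn₀⟩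
  · simp
  obtain ⟨K, hKs, hKS⟩ : ∃ K, s < K ∧ ∀ n ∈ S, n < K :=
    ⟨max s (S.sup id) + 1, by omega, fun n hn => by
      have : n ≤ S.sup id := Finset.le_sup (f := id) hn
      omega⟩
  have heval : ∀ n ∈ S, (e s) * ((∑ i ∈ Finset.range K, a i * (n.descFactorial i : ℤ_[p]) : ℤ_[p]) :
      ℚ_[p]) = C - w 0 := fun n hn => by
    rw [← hS n hn, PadicInt.coe_sum, Finset.mul_sum]
    have hsub : Finset.range (n + 1) ⊆ Finset.range K := by
      have := hKS n hn
      intro i; simp only [Finset.mem_range]; omega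
    have h1 : ∑ i ∈ Finset.range (n + 1), (n.choose i : ℤ) * p ^ i * w i =
        ∑ i ∈ Finset.range K, (n.choose i : ℤ) * p ^ i * w i := by
      refine Finset.sum_subset hsub fun i _ hi => ?_
      rw [Nat.choose_eq_zero_of_lt (by simpa using hi)]
      simp
    rw [h1, show K = (K - 1) + 1 by omega, Finset.sum_range_succ', Finset.sum_range_succ', ha0]
    push_cast
    simp only [zero_mul, mul_zero, add_zero, Nat.choose_zero_right, Nat.cast_one, pow_zero, one_mul,
      add_sub_cancel_right]
    refine Finset.sum_congr rfl fun i _ => ?_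
    rw [hacoe (i + 1) (by omega), Nat.descFactorial_eq_factorial_mul_choose]
    have := hfac (i + 1)
    rw [← mul_assoc, mul_div_cancel₀ _ hes]
    simp only [he]
    push_cast
    field_simp
  have heq : ∀ n ∈ S, ∑ i ∈ Finset.range K, a i * (n.descFactorial i : ℤ_[p]) =
      ∑ i ∈ Finset.range K, a i * (n₀.descFactorial i : ℤ_[p]) := fun n hn => by
    have := (heval n hn).trans (heval n₀ hn₀).symm
    exact Subtype.ext (mul_left_cancel₀ hes this)
  set γ := ∑ i ∈ Finset.range K, a i * (n₀.descFactorial i : ℤ_[p]) with hγ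
  set P : Polynomial ℤ_[p] := ∑ i ∈ Finset.range K, Polynomial.C (a i) * descPochhammer ℤ_[p] i -
    Polynomial.C γ with hP
  have hroot : ∀ n ∈ S, P.eval (n : ℤ_[p]) = 0 := fun n hn => by
    simp only [hP, Polynomial.eval_sub, Polynomial.eval_finsetSum, Polynomial.eval_mul,
      Polynomial.eval_C, descPochhammer_eval_eq_descFactorial]
    rw [heq n hn, sub_self]
  set Pbar := P.map (PadicInt.toZMod (p := p)) with hPbar
  have hPbar_eq : Pbar = ∑ i ∈ Finset.range s, Polynomial.C (PadicInt.toZMod (a i)) *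
      descPochhammer (ZMod p) i + descPochhammer (ZMod p) s - Polynomial.C (PadicInt.toZMod γ) := by
    have hs' : Finset.range (s + 1) ⊆ Finset.range K := by
      intro i; simp only [Finset.mem_range]; omega
    rw [hPbar, hP, Polynomial.map_sub, Polynomial.map_sum, ← Finset.sum_subset hs',
      Finset.sum_range_succ]
    · simp [has, descPochhammer_map]
    · intro i _ hi
      rw [Polynomial.map_mul, Polynomial.map_C, hagt i (by simpa using hi)]
      simp
  have hlow : (∑ i ∈ Finset.range s, Polynomial.C (PadicInt.toZMod (a i)) *
      descPochhammer (ZMod p) i - Polynomial.C (PadicInt.toZMod γ)).degree < (s : ℕ) := by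
    rw [sub_eq_add_neg, ← Polynomial.C_neg]
    refine (Polynomial.degree_add_le _ _).trans_lt (max_lt ?_ ?_)
    · refine Polynomial.mem_degreeLT.1 (Submodule.sum_mem _ fun i hi => ?_)
      refine Polynomial.mem_degreeLT.2 ?_
      rw [← Polynomial.smul_eq_C_mul]
      refine (Polynomial.degree_smul_le _ _).trans_lt ?_
      rw [Polynomial.degree_eq_natDegree (monic_descPochhammer _ _).ne_zero,
        descPochhammer_natDegree]
      exact_mod_cast Finset.mem_range.1 hi
    · exact Polynomial.degree_C_le.trans_lt (by exact_mod_cast hs1)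
  have hdeg : Pbar.degree = (s : ℕ) := by
    rw [hPbar_eq, add_sub_right_comm]
    have hd : (descPochhammer (ZMod p) s).degree = (s : ℕ) := by
      rw [Polynomial.degree_eq_natDegree (monic_descPochhammer _ _).ne_zero,
        descPochhammer_natDegree]
    rw [Polynomial.degree_add_eq_right_of_degree_lt (by rwa [hd]), hd]
  have hPbar0 : Pbar ≠ 0 := by
    rintro h
    rw [h, Polynomial.degree_zero] at hdeg
    exact absurd hdeg (by simp)
  have hP0 : P ≠ 0 := by
    rintro h
    exact hPbar0 (by rw [hPbar, h, Polynomial.map_zero])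
  have hdvd : (∏ n ∈ S, (Polynomial.X - Polynomial.C (n : ℤ_[p]))) ∣ P := by
    have h := (Multiset.prod_X_sub_C_dvd_iff_le_roots hP0 (S.val.map (fun n : ℕ => (n : ℤ_[p])))).2
      ((Multiset.le_iff_subset (S.nodup.map Nat.cast_injective)).2 fun x hx => by
        obtain ⟨n, hn, rfl⟩ := Multiset.mem_map.1 hx
        exact (Polynomial.mem_roots hP0).2 (hroot n hn))
    simpa [Multiset.map_map] using h
  have hdvd' := Polynomial.natDegree_le_of_dvd
    (Polynomial.map_dvd (PadicInt.toZMod (p := p)) hdvd) hPbar0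
  rw [Polynomial.natDegree_eq_of_degree_eq_some hdeg, Polynomial.map_prod] at hdvd'
  rw [Polynomial.natDegree_prod_of_monic _ _ (fun n _ => (Polynomial.monic_X_sub_C _).map _)] at hdvd'
  simpa only [Polynomial.map_sub, Polynomial.map_X, Polynomial.map_C, Polynomial.natDegree_X_sub_C,
    Finset.sum_const, smul_eq_mul, mul_one] using hdvd'

section
variable {r : ℕ}

lemma isUnit_aeval_of_forall_charpoly_isRoot (T : Matrix (Fin r) (Fin r) ℂ) (q : Polynomial ℂ)
    (hq : ∀ z, T.charpoly.IsRoot z → q.eval z ≠ 0) : IsUnit (Polynomial.aeval T q) := by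
  have hco : IsCoprime q T.charpoly := by
    rw [Polynomial.isCoprime_iff_aeval_ne_zero_of_isAlgClosed ℂ ℂ]
    intro z
    by_contra! h
    exact hq z (by simpa [Polynomial.IsRoot.def] using h.2) (by simpa using h.1)
  obtain ⟨a, b, hab⟩ := hco
  have h := congrArg (Polynomial.aeval T) hab
  rw [map_add, map_mul, map_mul, Matrix.aeval_self_charpoly, mul_zero, add_zero, map_one] at h
  exact IsUnit.of_mul_eq_one_right _ h

lemma vecMul_eq_zero_of_isUnit {T : Matrix (Fin r) (Fin r) ℂ} (hT : IsUnit T) {x : Fin r → ℂ}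
    (hx : x ᵥ* T = 0) : x = 0 := by
  obtain ⟨u, rfl⟩ := hT
  have h := congrArg (fun y => y ᵥ* (↑u⁻¹ : Matrix (Fin r) (Fin r) ℂ)) hx
  simpa [Matrix.vecMul_vecMul] using h

lemma ne_zero_of_charpoly_isRoot {T : Matrix (Fin r) (Fin r) ℂ} (hT : T.det ≠ 0) {z : ℂ}
    (hz : T.charpoly.IsRoot z) : z ≠ 0 := by
  rintro rfl
  apply hT
  rw [Matrix.det_eq_sign_charpoly_coeff, Polynomial.coeff_zero_eq_eval_zero, hz, mul_zero]

/-- If distinct eigenvalues of `T` have distinct `M`-th powers, eigenvectors of `T ^ M` are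
eigenvectors of `T`. -/
lemma exists_vecMul_eq_smul_of_vecMul_pow {T : Matrix (Fin r) (Fin r) ℂ} (hT : T.det ≠ 0)
    {M : ℕ} (hM : 0 < M)
    (hinj : ∀ z w, T.charpoly.IsRoot z → T.charpoly.IsRoot w → z ^ M = w ^ M → z = w)
    {x : Fin r → ℂ} {μ : ℂ} (hx : x ᵥ* (T ^ M) = μ • x) : ∃ θ : ℂ, x ᵥ* T = θ • x := by
  have hx0 : x ᵥ* (Polynomial.aeval T (Polynomial.X ^ M - Polynomial.C μ)) = 0 := by
    rw [map_sub, map_pow, Polynomial.aeval_X, Polynomial.aeval_C, Matrix.vecMul_sub, hx,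
      Algebra.algebraMap_eq_smul_one, Matrix.vecMul_smul, Matrix.vecMul_one, sub_self]
  by_cases h : ∃ θ, T.charpoly.IsRoot θ ∧ θ ^ M = μ
  · obtain ⟨θ, hθ, rfl⟩ := h
    refine ⟨θ, ?_⟩
    obtain ⟨Q, hQ⟩ : (Polynomial.X - Polynomial.C θ) ∣
        (Polynomial.X ^ M - Polynomial.C (θ ^ M) : Polynomial ℂ) := by
      rw [Polynomial.dvd_iff_isRoot]; simp
    have hQu : IsUnit (Polynomial.aeval T Q) := by
      refine isUnit_aeval_of_forall_charpoly_isRoot T Q fun z hz hQz => ?_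
      have hzM : z ^ M = θ ^ M := by
        have := congrArg (Polynomial.eval z) hQ
        simp only [Polynomial.eval_sub, Polynomial.eval_pow, Polynomial.eval_X, Polynomial.eval_C,
          Polynomial.eval_mul, hQz, mul_zero] at this
        exact sub_eq_zero.1 this
      obtain rfl := hinj z θ hz hθ hzM
      have hd := congrArg (fun P => Polynomial.eval z (Polynomial.derivative P)) hQ
      simp only [Polynomial.derivative_sub, Polynomial.derivative_X_pow, Polynomial.derivative_C,
        Polynomial.derivative_mul, Polynomial.derivative_X, Polynomial.eval_sub,
        Polynomial.eval_add, Polynomial.eval_mul, Polynomial.eval_C, Polynomial.eval_pow,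
        Polynomial.eval_X, Polynomial.eval_one, hQz, sub_self, sub_zero,
        zero_mul, mul_zero, add_zero] at hd
      exact mul_ne_zero (Nat.cast_ne_zero.2 hM.ne')
        (pow_ne_zero _ (ne_zero_of_charpoly_isRoot hT hz)) hd
    rw [hQ, map_mul, ← Matrix.vecMul_vecMul] at hx0
    have := vecMul_eq_zero_of_isUnit hQu hx0
    rw [map_sub, Polynomial.aeval_X, Polynomial.aeval_C, Matrix.vecMul_sub,
      Algebra.algebraMap_eq_smul_one, Matrix.vecMul_smul, Matrix.vecMul_one] at this
    exact sub_eq_zero.1 this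
  · refine ⟨0, ?_⟩
    have := vecMul_eq_zero_of_isUnit (isUnit_aeval_of_forall_charpoly_isRoot T _ fun z hz h0 =>
      h ⟨z, hz, sub_eq_zero.1 (by simpa using h0)⟩) hx0
    simp [this]

/-- A cyclic vector of `T` is cyclic for `T ^ M` when distinct eigenvalues of `T` have distinct
`M`-th powers. -/
lemma eq_zero_of_forall_dotProduct_pow_mul {T : Matrix (Fin r) (Fin r) ℂ} (hT : T.det ≠ 0)
    {c : Fin r → ℂ} (hc : ∀ x : Fin r → ℂ, (∀ n, x ⬝ᵥ (T ^ n *ᵥ c) = 0) → x = 0)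
    {M : ℕ} (hM : 0 < M)
    (hinj : ∀ z w, T.charpoly.IsRoot z → T.charpoly.IsRoot w → z ^ M = w ^ M → z = w)
    (x : Fin r → ℂ) (hx : ∀ n, x ⬝ᵥ (T ^ (M * n) *ᵥ c) = 0) : x = 0 := by
  let W : Submodule ℂ (Fin r → ℂ) :=
    { carrier := {y | ∀ n, y ⬝ᵥ (T ^ (M * n) *ᵥ c) = 0}
      add_mem' := fun ha hb n => by rw [add_dotProduct, ha n, hb n, add_zero]
      zero_mem' := fun n => zero_dotProduct _
      smul_mem' := fun t a ha n => by rw [smul_dotProduct, ha n, smul_zero] }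
  let F : Module.End ℂ (Fin r → ℂ) := (T ^ M).vecMulLinear
  have hF : ∀ y ∈ W, F y ∈ W := fun y hy n => by
    change (y ᵥ* (T ^ M)) ⬝ᵥ _ = 0
    rw [← Matrix.dotProduct_mulVec, Matrix.mulVec_mulVec, ← pow_add,
      show M + M * n = M * (n + 1) by ring]
    exact hy (n + 1)
  by_contra hx0
  have : Nontrivial W := ⟨⟨⟨x, hx⟩, 0, fun h => hx0 (congrArg Subtype.val h)⟩⟩
  obtain ⟨μ, hμ⟩ := Module.End.exists_eigenvalue (F.restrict hF)
  obtain ⟨⟨y, hyW⟩, hy⟩ := hμ.exists_hasEigenvector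
  have hy0 : y ≠ 0 := fun h => hy.2 (Subtype.ext h)
  have hyμ : y ᵥ* (T ^ M) = μ • y := congrArg Subtype.val hy.apply_eq_smul
  obtain ⟨θ, hθ⟩ := exists_vecMul_eq_smul_of_vecMul_pow hT hM hinj hyμ
  refine hy0 (hc y fun n => ?_)
  have hpow : y ᵥ* (T ^ n) = θ ^ n • y := by
    induction n with
    | zero => simp
    | succ n ih => rw [pow_succ, ← Matrix.vecMul_vecMul, ih, Matrix.smul_vecMul, hθ, smul_smul,
        pow_succ]
  have h0 : y ⬝ᵥ c = 0 := by simpa using hyW 0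
  rw [Matrix.dotProduct_mulVec, hpow, smul_dotProduct, h0, smul_zero]

lemma exists_pow_eq_one_add_smul {B : Matrix (Fin r) (Fin r) ℤ} {p : ℕ} [Fact p.Prime]
    (hp : ¬ (p : ℤ) ∣ B.det) :
    ∃ M, 0 < M ∧ ∃ E : Matrix (Fin r) (Fin r) ℤ, B ^ M = 1 + (p : ℤ) • E := by
  let f := Int.castRingHom (ZMod p)
  have hu : IsUnit (f.mapMatrix B) := by
    rw [Matrix.isUnit_iff_isUnit_det, ← RingHom.map_det, isUnit_iff_ne_zero]
    intro h
    exact hp ((ZMod.intCast_zmod_eq_zero_iff_dvd _ _).1 h)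
  obtain ⟨u, hu⟩ := hu
  refine ⟨orderOf u, orderOf_pos u, ?_⟩
  have h1 : f.mapMatrix (B ^ orderOf u) = 1 := by
    rw [map_pow, ← hu, ← Units.val_pow_eq_pow_val, pow_orderOf_eq_one, Units.val_one]
  have h2 : ∀ i j, ∃ z : ℤ, (B ^ orderOf u) i j - (1 : Matrix (Fin r) (Fin r) ℤ) i j = p * z :=
    fun i j => by
      change (p : ℤ) ∣ _
      rw [← ZMod.intCast_zmod_eq_zero_iff_dvd]
      have h3 : f.mapMatrix (B ^ orderOf u - 1) = 0 := by rw [map_sub, h1, map_one, sub_self]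
      exact congrFun (congrFun h3 i) j
  choose E hE using h2
  refine ⟨Matrix.of E, ?_⟩
  ext i j
  have := hE i j
  simp only [Matrix.add_apply, Matrix.smul_apply, Matrix.of_apply, smul_eq_mul]
  linarith

lemma mapMatrix_dotProduct_pow_mulVec (f : ℤ →+* ℂ) (B : Matrix (Fin r) (Fin r) ℤ)
    (h m : Fin r → ℤ) (n : ℕ) :
    (f ∘ h) ⬝ᵥ ((f.mapMatrix B) ^ n *ᵥ (f ∘ m)) = f (h ⬝ᵥ (B ^ n *ᵥ m)) := by
  rw [← map_pow, RingHom.map_dotProduct]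
  congr 1
  funext i
  exact (RingHom.map_mulVec f (B ^ n) m i).symm

/-- Uniform bound for the multiplicities of the linear recurrence `n ↦ h ⬝ᵥ (B ^ n *ᵥ m)` when the
eigenvalues of `B` are nondegenerate and `m` is a cyclic vector. -/
lemma exists_card_le_of_dotProduct_pow_eq {B : Matrix (Fin r) (Fin r) ℤ} (hB : B.det ≠ 0)
    {m : Fin r → ℤ}
    (hm : ∀ x : Fin r → ℂ, (∀ n, x ⬝ᵥ (((Int.castRingHom ℂ).mapMatrix B) ^ n *ᵥ
      (Int.castRingHom ℂ ∘ m)) = 0) → x = 0)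
    (hinj : ∀ M, 0 < M → ∀ z w, ((Int.castRingHom ℂ).mapMatrix B).charpoly.IsRoot z →
      ((Int.castRingHom ℂ).mapMatrix B).charpoly.IsRoot w → z ^ M = w ^ M → z = w)
    (hone : ∀ M, 0 < M → ∀ z, ((Int.castRingHom ℂ).mapMatrix B).charpoly.IsRoot z → z ^ M ≠ 1)
    {h : Fin r → ℤ} (hh : h ≠ 0) :
    ∃ K : ℕ, ∀ (C : ℤ) (S : Finset ℕ), (∀ n ∈ S, h ⬝ᵥ (B ^ n *ᵥ m) = C) → S.card ≤ K := by
  classical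
  set f := Int.castRingHom ℂ with hf
  have hfinj : Function.Injective f := Int.cast_injective
  set T := f.mapMatrix B with hTdef
  have hT : T.det ≠ 0 := by
    rw [hTdef, ← RingHom.map_det]
    exact fun h0 => hB (hfinj (h0.trans (map_zero f).symm))
  obtain ⟨p, hpge, hp⟩ := Nat.exists_infinite_primes (B.det.natAbs + 3)
  have : Fact p.Prime := ⟨hp⟩
  have hpdvd : ¬ (p : ℤ) ∣ B.det := fun hd => by
    have h1 := Nat.le_of_dvd (Int.natAbs_pos.2 hB) (Int.natCast_dvd.1 hd)
    omega
  obtain ⟨M, hM, E, hE⟩ := exists_pow_eq_one_add_smul hpdvd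
  have hexp : ∀ n j, h ⬝ᵥ (B ^ (j + M * n) *ᵥ m) = ∑ i ∈ Finset.range (n + 1),
      (n.choose i : ℤ) * p ^ i * (h ⬝ᵥ ((B ^ j * E ^ i) *ᵥ m)) := fun n j => by
    have h1 : B ^ (j + M * n) = ∑ i ∈ Finset.range (n + 1),
        ((n.choose i : ℤ) * p ^ i) • (B ^ j * E ^ i) := by
      rw [pow_add, pow_mul, hE, add_comm, (Commute.one_right _).add_pow, Finset.mul_sum]
      refine Finset.sum_congr rfl fun i _ => ?_
      rw [one_pow, mul_one, smul_pow, ← Nat.cast_comm, ← nsmul_eq_mul, mul_smul_comm,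
        mul_smul_comm, mul_smul, natCast_zsmul]
    rw [h1, Matrix.sum_mulVec, dotProduct_sum]
    refine Finset.sum_congr rfl fun i _ => ?_
    rw [Matrix.smul_mulVec, dotProduct_smul, smul_eq_mul]
  have hw : ∀ j, ∃ i, 1 ≤ i ∧ h ⬝ᵥ ((B ^ j * E ^ i) *ᵥ m) ≠ 0 := fun j => by
    by_contra! hcon
    have hconst : ∀ n, h ⬝ᵥ (B ^ (j + M * n) *ᵥ m) = h ⬝ᵥ (B ^ j *ᵥ m) := fun n => by
      rw [hexp, Finset.sum_range_succ', Finset.sum_eq_zero]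
      · simp
      · intro i _
        rw [hcon (i + 1) (by omega), mul_zero]
    have hzero : f ∘ (h ᵥ* (B ^ j * (B ^ M - 1))) = 0 := by
      refine eq_zero_of_forall_dotProduct_pow_mul hT hm hM (hinj M hM) _ fun n => ?_
      rw [mapMatrix_dotProduct_pow_mulVec, ← Matrix.dotProduct_mulVec, Matrix.mulVec_mulVec,
        mul_assoc, sub_mul, one_mul, ← pow_add, mul_sub, ← pow_add, ← pow_add, Matrix.sub_mulVec,
        dotProduct_sub, show j + (M + M * n) = j + M * (n + 1) by ring, hconst, hconst, sub_self,
        map_zero]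
    have hzero' : h ᵥ* (B ^ j * (B ^ M - 1)) = 0 := by
      funext i
      exact hfinj ((congrFun hzero i).trans (map_zero f).symm)
    have hdet : (B ^ j * (B ^ M - 1)).det = 0 :=
      Matrix.exists_vecMul_eq_zero_iff.1 ⟨h, hh, hzero'⟩
    rw [Matrix.det_mul, Matrix.det_pow] at hdet
    have hdet2 : (B ^ M - 1).det = 0 := (mul_eq_zero.1 hdet).resolve_left (pow_ne_zero _ hB)
    have hu : IsUnit (Polynomial.aeval T (Polynomial.X ^ M - 1 : Polynomial ℂ)) :=
      isUnit_aeval_of_forall_charpoly_isRoot T _ fun z hz h0 =>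
        hone M hM z hz (sub_eq_zero.1 (by simpa using h0))
    rw [map_sub, map_pow, Polynomial.aeval_X, map_one, Matrix.isUnit_iff_isUnit_det,
      isUnit_iff_ne_zero] at hu
    apply hu
    have h2 : T ^ M - 1 = f.mapMatrix (B ^ M - 1) := by rw [map_sub, map_pow, map_one]
    rw [h2, ← RingHom.map_det, hdet2, map_zero]
  have hp2 : 2 < p := by omega
  choose s hs using fun j => exists_card_le_of_sum_choose_mul_pow hp2
    (fun i => h ⬝ᵥ ((B ^ j * E ^ i) *ᵥ m)) (hw j)
  refine ⟨∑ j ∈ Finset.range M, s j, fun C S hS => ?_⟩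
  have hmaps : ∀ n ∈ S, n % M ∈ Finset.range M := fun n _ => Finset.mem_range.2 (Nat.mod_lt _ hM)
  rw [Finset.card_eq_sum_card_fiberwise hmaps]
  refine Finset.sum_le_sum fun j _ => ?_
  have hinjOn : Set.InjOn (fun n => n / M) ({n ∈ S | n % M = j} : Finset ℕ) := fun a ha b hb hab => by
    simp only [Finset.coe_filter, Set.mem_ofPred_eq] at ha hb
    rw [← Nat.mod_add_div a M, ← Nat.mod_add_div b M, ha.2, hb.2]
    simp only at hab
    rw [hab]
  rw [← Finset.card_image_of_injOn hinjOn]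
  refine hs j C _ fun n hn => ?_
  obtain ⟨a, ha, rfl⟩ := Finset.mem_image.1 hn
  simp only [Finset.mem_filter] at ha
  rw [← hexp, ← hS a ha.1, ← ha.2, Nat.mod_add_div]

end

/-- The character `x ↦ exp (2 π i x)` of `ℝ`. -/
noncomputable def expTwoPi (x : ℝ) : ℂ := Complex.exp ((2 * Real.pi * x : ℝ) * Complex.I)

lemma continuous_expTwoPi : Continuous expTwoPi := by
  unfold expTwoPi
  fun_prop

lemma norm_expTwoPi (x : ℝ) : ‖expTwoPi x‖ = 1 := Complex.norm_exp_ofReal_mul_I _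

lemma expTwoPi_add (x y : ℝ) : expTwoPi (x + y) = expTwoPi x * expTwoPi y := by
  rw [expTwoPi, expTwoPi, expTwoPi, ← Complex.exp_add]
  congr 1
  push_cast
  ring

lemma conj_expTwoPi (x : ℝ) : (starRingEnd ℂ) (expTwoPi x) = expTwoPi (-x) := by
  rw [expTwoPi, expTwoPi, ← Complex.exp_conj, map_mul, Complex.conj_ofReal, Complex.conj_I]
  congr 1
  push_cast
  ring

lemma expTwoPi_zero : expTwoPi 0 = 1 := by simp [expTwoPi]

lemma expTwoPi_intCast (k : ℤ) : expTwoPi k = 1 := by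
  rw [expTwoPi, ← Complex.exp_int_mul_two_pi_mul_I k]
  congr 1
  push_cast
  ring

lemma expTwoPi_sum {ι : Type*} (s : Finset ι) (x : ι → ℝ) :
    expTwoPi (∑ i ∈ s, x i) = ∏ i ∈ s, expTwoPi (x i) := by
  classical
  induction s using Finset.induction_on with
  | empty => simp [expTwoPi_zero]
  | insert a s ha ih => rw [Finset.sum_insert ha, Finset.prod_insert ha, expTwoPi_add, ih]

lemma integral_expTwoPi_intCast_mul (a : ℝ) (k : ℤ) :
    ∫ x in a..(a + 1), expTwoPi (k * x) = if k = 0 then 1 else 0 := by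
  split_ifs with hk
  · simp [hk, expTwoPi_zero]
  · have hc : (2 * Real.pi * k * Complex.I : ℂ) ≠ 0 := by
      simp [hk, Real.pi_ne_zero]
    have h : ∀ x : ℝ, expTwoPi (k * x) = Complex.exp ((2 * Real.pi * k * Complex.I : ℂ) * x) :=
      fun x => by
        rw [expTwoPi]
        congr 1
        push_cast
        ring
    simp_rw [h]
    rw [integral_exp_mul_complex hc, ← h, ← h, mul_add, mul_one, expTwoPi_add, expTwoPi_intCast,
      mul_one, sub_self, zero_div]

lemma integral_norm_sum_expTwoPi_sq_le {u : ℕ → ℤ} {K : ℕ}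
    (hK : ∀ (C : ℤ) (S : Finset ℕ), (∀ n ∈ S, u n = C) → S.card ≤ K) (a : ℝ) (N : ℕ) :
    ∫ x in a..(a + 1), ‖∑ n ∈ Finset.range N, expTwoPi (u n * x)‖ ^ 2 ≤ N * K := by
  have hint : ∀ k : ℤ, IntervalIntegrable (fun x : ℝ => expTwoPi (k * x)) volume a (a + 1) :=
    fun k => (continuous_expTwoPi.comp (by fun_prop)).intervalIntegrable _ _
  have h1 : ∀ x : ℝ, ((‖∑ n ∈ Finset.range N, expTwoPi (u n * x)‖ ^ 2 : ℝ) : ℂ) =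
      ∑ m ∈ Finset.range N, ∑ n ∈ Finset.range N, expTwoPi ((u m - u n : ℤ) * x) := fun x => by
    rw [Complex.ofReal_pow, ← Complex.mul_conj', map_sum, Finset.sum_mul_sum]
    refine Finset.sum_congr rfl fun m _ => Finset.sum_congr rfl fun n _ => ?_
    rw [conj_expTwoPi, ← expTwoPi_add]
    congr 1
    push_cast
    ring
  have h2 : ((∫ x in a..(a + 1), ‖∑ n ∈ Finset.range N, expTwoPi (u n * x)‖ ^ 2 : ℝ) : ℂ) =
      ((∑ m ∈ Finset.range N, ((Finset.range N).filter fun n => u n = u m).card : ℕ) : ℂ) := by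
    rw [← intervalIntegral.integral_ofReal]
    simp_rw [h1]
    rw [intervalIntegral.integral_finsetSum fun m _ => ?_, Nat.cast_sum]
    · refine Finset.sum_congr rfl fun m _ => ?_
      rw [intervalIntegral.integral_finsetSum fun n _ => hint _]
      simp_rw [integral_expTwoPi_intCast_mul, sub_eq_zero, eq_comm (a := u m)]
      rw [Finset.sum_boole]
    · have := IntervalIntegrable.sum (Finset.range N) (f := fun n x => expTwoPi ((u m - u n : ℤ) * x))
        (μ := volume) (a := a) (b := a + 1) fun n _ => hint _
      simpa [Finset.sum_fn] using this
  have h3 : ∫ x in a..(a + 1), ‖∑ n ∈ Finset.range N, expTwoPi (u n * x)‖ ^ 2 =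
      ((∑ m ∈ Finset.range N, ((Finset.range N).filter fun n => u n = u m).card : ℕ) : ℝ) := by
    exact_mod_cast h2
  rw [h3]
  have h4 : ∑ m ∈ Finset.range N, ((Finset.range N).filter fun n => u n = u m).card ≤ N * K := by
    refine (Finset.sum_le_card_nsmul _ _ K fun m _ => hK (u m) _ fun n hn => ?_).trans (by simp)
    exact (Finset.mem_filter.1 hn).2
  exact_mod_cast h4

lemma tendsto_average_of_tendsto_average_sq {z : ℕ → ℂ} (hz : ∀ n, ‖z n‖ ≤ 1)
    (h : Tendsto (fun m : ℕ => ‖∑ n ∈ Finset.range (m ^ 2), z n‖ / (m : ℝ) ^ 2) atTop (nhds 0)) :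
    Tendsto (fun N : ℕ => (N : ℂ)⁻¹ • ∑ n ∈ Finset.range N, z n) atTop (nhds 0) := by
  have hsq : Tendsto Nat.sqrt atTop atTop :=
    tendsto_atTop_atTop.2 fun b => ⟨b ^ 2, fun a ha => Nat.le_sqrt'.2 ha⟩
  have hlim : Tendsto (fun m : ℕ => ‖∑ n ∈ Finset.range (m ^ 2), z n‖ / (m : ℝ) ^ 2 + 2 / (m : ℝ))
      atTop (nhds 0) := by
    simpa using h.add (tendsto_const_div_atTop_nhds_zero_nat (2 : ℝ))
  refine squeeze_zero_norm' ?_ (hlim.comp hsq)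
  filter_upwards [eventually_ge_atTop 1] with N hN
  have hm1 : 1 ≤ Nat.sqrt N := Nat.le_sqrt'.2 (by simpa using hN)
  have hmN : Nat.sqrt N ^ 2 ≤ N := Nat.sqrt_le' N
  have hNm : N ≤ Nat.sqrt N * Nat.sqrt N + Nat.sqrt N + Nat.sqrt N := Nat.sqrt_le_add N
  simp only [Function.comp_apply]
  set m := Nat.sqrt N
  have hm0 : (0 : ℝ) < m := by exact_mod_cast hm1
  have hsplit : ‖∑ n ∈ Finset.range N, z n‖ ≤ ‖∑ n ∈ Finset.range (m ^ 2), z n‖ + 2 * m := by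
    rw [← Finset.sum_range_add_sum_Ico _ hmN]
    refine (norm_add_le _ _).trans (add_le_add le_rfl ?_)
    refine (norm_sum_le_of_le _ fun n _ => hz n).trans ?_
    rw [Finset.sum_const, Nat.card_Ico, nsmul_eq_mul, mul_one]
    have : N - m ^ 2 ≤ 2 * m := by rw [pow_two] at *; omega
    exact_mod_cast this
  rw [norm_smul, norm_inv, Complex.norm_natCast, inv_mul_eq_div]
  calc ‖∑ n ∈ Finset.range N, z n‖ / N
      ≤ (‖∑ n ∈ Finset.range (m ^ 2), z n‖ + 2 * m) / (m : ℝ) ^ 2 := by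
        gcongr
        exact_mod_cast hmN
    _ = _ := by
        field_simp

/-- A Weyl-type metric theorem: for integers `u n` of bounded multiplicity, the exponential
averages along `u n * x` tend to zero for almost every `x`. -/
lemma ae_tendsto_average_expTwoPi {u : ℕ → ℤ} {K : ℕ}
    (hK : ∀ (C : ℤ) (S : Finset ℕ), (∀ n ∈ S, u n = C) → S.card ≤ K) :
    ∀ᵐ x ∂(volume : Measure ℝ), Tendsto (fun N : ℕ => (N : ℂ)⁻¹ • ∑ n ∈ Finset.range N,
      expTwoPi (u n * x)) atTop (nhds 0) := by
  have hcont : ∀ N, Continuous fun x : ℝ => ∑ n ∈ Finset.range N, expTwoPi (u n * x) := fun N =>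
    continuous_finsetSum _ fun n _ => continuous_expTwoPi.comp (by fun_prop)
  have hcont2 : ∀ m : ℕ, Continuous fun x : ℝ =>
      (‖∑ n ∈ Finset.range (m ^ 2), expTwoPi (u n * x)‖ / (m : ℝ) ^ 2) ^ 2 := fun m =>
    ((hcont _).norm.div_const _).pow 2
  have hloc : ∀ a : ℤ, ∀ᵐ x ∂(volume.restrict (Set.Ioc (a : ℝ) (a + 1))),
      Tendsto (fun N : ℕ => (N : ℂ)⁻¹ • ∑ n ∈ Finset.range N, expTwoPi (u n * x)) atTop
        (nhds 0) := fun a => by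
    have hbound : ∀ m : ℕ, ∫⁻ x in Set.Ioc (a : ℝ) (a + 1), ENNReal.ofReal
        ((‖∑ n ∈ Finset.range (m ^ 2), expTwoPi (u n * x)‖ / (m : ℝ) ^ 2) ^ 2) ≤
        ENNReal.ofReal (K * (1 / (m : ℝ) ^ 2)) := fun m => by
      rw [← ofReal_integral_eq_lintegral_ofReal]
      · apply ENNReal.ofReal_le_ofReal
        rw [← intervalIntegral.integral_of_le (by linarith)]
        simp_rw [div_pow]
        rw [intervalIntegral.integral_div]
        have h := integral_norm_sum_expTwoPi_sq_le hK a (m ^ 2)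
        rcases Nat.eq_zero_or_pos m with rfl | hm
        · simp
        · have hm0 : (0 : ℝ) < m := by exact_mod_cast hm
          rw [div_le_iff₀ (by positivity)]
          refine h.trans (le_of_eq ?_)
          push_cast
          field_simp
      · exact ((hcont2 m).integrableOn_Icc (a := (a : ℝ)) (b := a + 1)).mono_set
          Set.Ioc_subset_Icc_self
      · exact Eventually.of_forall fun x => sq_nonneg _
    have hsum : ∫⁻ x in Set.Ioc (a : ℝ) (a + 1), ∑' m : ℕ, ENNReal.ofReal
        ((‖∑ n ∈ Finset.range (m ^ 2), expTwoPi (u n * x)‖ / (m : ℝ) ^ 2) ^ 2) ≠ ⊤ := by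
      rw [lintegral_tsum fun m => ((hcont2 m).measurable.ennreal_ofReal).aemeasurable]
      refine ne_top_of_le_ne_top ?_ (ENNReal.tsum_le_tsum hbound)
      exact ((Real.summable_one_div_nat_pow.2 one_lt_two).mul_left (K : ℝ)).tsum_ofReal_ne_top
    filter_upwards [ae_lt_top (Measurable.tsum fun m =>
      (hcont2 m).measurable.ennreal_ofReal) hsum] with x hx
    refine tendsto_average_of_tendsto_average_sq (fun n => (norm_expTwoPi _).le) ?_
    have h0 := ENNReal.tendsto_atTop_zero_of_tsum_ne_top hx.ne
    have h1 := (ENNReal.tendsto_toReal ENNReal.zero_ne_top).comp h0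
    have h2 : Tendsto (fun m : ℕ =>
        (‖∑ n ∈ Finset.range (m ^ 2), expTwoPi (u n * x)‖ / (m : ℝ) ^ 2) ^ 2) atTop (nhds 0) := by
      refine h1.congr fun m => ?_
      simp only [Function.comp_apply]
      exact ENNReal.toReal_ofReal (sq_nonneg _)
    have h3 := h2.sqrt
    rw [Real.sqrt_zero] at h3
    exact h3.congr fun m => Real.sqrt_sq (by positivity)
  have hcover : (⋃ a : ℤ, Set.Ioc (a : ℝ) (a + 1)) = Set.univ := by
    have := iUnion_Ioc_intCast ℝ
    simpa using this
  have := (ae_restrict_iUnion_iff (μ := volume) (fun a : ℤ => Set.Ioc (a : ℝ) (a + 1))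
    (fun x => Tendsto (fun N : ℕ => (N : ℂ)⁻¹ • ∑ n ∈ Finset.range N, expTwoPi (u n * x)) atTop
        (nhds 0))).2 hloc
  rwa [hcover, Measure.restrict_univ] at this

section
variable {r : ℕ}

lemma setIntegral_Icc_expTwoPi (h : Fin r → ℤ) :
    ∫ y in Set.Icc (0 : Fin r → ℝ) 1, expTwoPi (∑ i, h i * y i) = if h = 0 then 1 else 0 := by
  have h1 : ∀ k : ℤ, ∫ y in Set.Icc (0 : ℝ) 1, expTwoPi (k * y) = if k = 0 then 1 else 0 :=
    fun k => by
      rw [integral_Icc_eq_integral_Ioc, ← intervalIntegral.integral_of_le zero_le_one]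
      simpa using integral_expTwoPi_intCast_mul 0 k
  simp_rw [expTwoPi_sum]
  rw [← Set.pi_univ_Icc, volume_pi, Measure.restrict_pi_pi,
    integral_fintype_prod_eq_prod (fun i y => expTwoPi (h i * y))]
  simp only [Pi.zero_apply, Pi.one_apply, h1]
  rw [Finset.prod_ite_zero]
  simp [funext_iff]

lemma UDMod1.tendsto_average_expTwoPi {x : ℕ → Fin r → ℝ} (hx : UDMod1 x) {h : Fin r → ℤ}
    (hh : h ≠ 0) :
    Tendsto (fun N : ℕ => (N : ℂ)⁻¹ • ∑ n ∈ Finset.range N, expTwoPi (∑ i, h i * x n i)) atTop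
      (nhds 0) := by
  have := hx (fun y => expTwoPi (∑ i, h i * y i)) (continuous_expTwoPi.comp (by fun_prop))
    fun y k => by
      have : ∑ i, (h i : ℝ) * (y i + k i) = ∑ i, h i * y i + (∑ i, h i * k i : ℤ) := by
        push_cast
        simp_rw [mul_add, Finset.sum_add_distrib]
      simp only [Pi.add_apply]
      rw [this, expTwoPi_add, expTwoPi_intCast, mul_one]
  rwa [setIntegral_Icc_expTwoPi, if_neg hh] at this

lemma exists_continuousMap_torus_of_periodic {f : (Fin r → ℝ) → ℂ} (hf : Continuous f)
    (hper : ∀ (y : Fin r → ℝ) (k : Fin r → ℤ), f (y + fun i => (k i : ℝ)) = f y) :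
    ∃ F : C(UnitAddTorus (Fin r), ℂ), ∀ y : Fin r → ℝ,
      F (fun i => (y i : UnitAddCircle)) = f y := by
  have hq : IsOpenQuotientMap (Pi.map fun (_ : Fin r) (t : ℝ) => (t : UnitAddCircle)) :=
    IsOpenQuotientMap.piMap fun _ => QuotientAddGroup.isOpenQuotientMap_mk
  let π : C(Fin r → ℝ, UnitAddTorus (Fin r)) := ⟨_, hq.continuous⟩
  have hπ : Topology.IsQuotientMap π := hq.isQuotientMap
  have hfac : Function.FactorsThrough (⟨f, hf⟩ : C(Fin r → ℝ, ℂ)) π := fun a b hab => by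
    have hk : ∀ i, ∃ k : ℤ, a i + k = b i := fun i => by
      have h1 : (a i : UnitAddCircle) = (b i : UnitAddCircle) := congrFun hab i
      rw [QuotientAddGroup.eq, AddSubgroup.mem_zmultiples_iff] at h1
      obtain ⟨k, hk⟩ := h1
      refine ⟨k, ?_⟩
      simp only [zsmul_eq_mul, mul_one] at hk
      linarith
    choose k hk using hk
    have hb : b = a + fun i => (k i : ℝ) := funext fun i => (hk i).symm
    change f a = f b
    rw [hb, hper]
  refine ⟨hπ.lift _ hfac, fun y => ?_⟩
  exact congrArg (fun g : C(Fin r → ℝ, ℂ) => g y) (hπ.lift_comp _ hfac)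

lemma mFourier_coe_eq_expTwoPi (h : Fin r → ℤ) (y : Fin r → ℝ) :
    UnitAddTorus.mFourier h (fun i => (y i : UnitAddCircle)) = expTwoPi (∑ i, h i * y i) := by
  rw [expTwoPi_sum, UnitAddTorus.mFourier, ContinuousMap.coe_mk]
  refine Finset.prod_congr rfl fun i _ => ?_
  rw [fourier_coe_apply, expTwoPi]
  congr 1
  push_cast
  ring

/-- Weyl's criterion. -/
lemma udMod1_of_tendsto_average_expTwoPi {x : ℕ → Fin r → ℝ}
    (hx : ∀ h : Fin r → ℤ, h ≠ 0 → Tendsto (fun N : ℕ => (N : ℂ)⁻¹ • ∑ n ∈ Finset.range N,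
      expTwoPi (∑ i, h i * x n i)) atTop (nhds 0)) : UDMod1 x := by
  intro f hf hper
  obtain ⟨F, hF⟩ := exists_continuousMap_torus_of_periodic hf hper
  let q : (Fin r → ℝ) → UnitAddTorus (Fin r) := fun y i => (y i : UnitAddCircle)
  have hq : Continuous q := continuous_pi fun i =>
    (AddCircle.continuous_mk' (1 : ℝ)).comp (continuous_apply i)
  let avg : C(UnitAddTorus (Fin r), ℂ) → ℕ → ℂ := fun G N =>
    (N : ℂ)⁻¹ • ∑ n ∈ Finset.range N, G (q (x n))
  let I : C(UnitAddTorus (Fin r), ℂ) → ℂ := fun G => ∫ y in Set.Icc (0 : Fin r → ℝ) 1, G (q y)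
  have hint : ∀ G : C(UnitAddTorus (Fin r), ℂ),
      IntegrableOn (fun y => G (q y)) (Set.Icc (0 : Fin r → ℝ) 1) := fun G =>
    (G.continuous.comp hq).continuousOn.integrableOn_compact isCompact_Icc
  have hspan : ∀ G ∈ Submodule.span ℂ (Set.range (UnitAddTorus.mFourier (d := Fin r))),
      Tendsto (avg G) atTop (nhds (I G)) := fun G hG => by
    induction hG using Submodule.span_induction with
    | mem G hG =>
      obtain ⟨h, rfl⟩ := hG
      simp only [avg, I, q, mFourier_coe_eq_expTwoPi, setIntegral_Icc_expTwoPi]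
      split_ifs with hh
      · subst hh
        refine tendsto_const_nhds.congr' ?_
        filter_upwards [eventually_ge_atTop 1] with N hN
        have : (N : ℂ) ≠ 0 := by exact_mod_cast (by omega : N ≠ 0)
        simp [expTwoPi_zero, this]
      · exact hx h hh
    | zero => simp [avg, I]
    | add G H _ _ hG hH =>
      have h1 : I (G + H) = I G + I H := integral_add (hint G) (hint H)
      rw [h1]
      refine (hG.add hH).congr fun N => ?_
      simp [avg, Finset.sum_add_distrib, mul_add]
    | smul a G _ hG =>
      have h1 : I (a • G) = a • I G := integral_smul a _
      rw [h1]
      refine (hG.const_smul a).congr fun N => ?_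
      simp only [avg, ContinuousMap.smul_apply, smul_eq_mul, ← Finset.mul_sum]
      ring
  have havg : ∀ (G H : C(UnitAddTorus (Fin r), ℂ)) (N : ℕ), ‖avg G N - avg H N‖ ≤ ‖G - H‖ :=
    fun G H N => by
      simp only [avg]
      rw [← smul_sub, ← Finset.sum_sub_distrib, norm_smul, norm_inv, Complex.norm_natCast]
      refine inv_mul_le_of_le_mul₀ (Nat.cast_nonneg _) (norm_nonneg _) ?_
      refine (norm_sum_le_of_le _ fun n _ => (G - H).norm_coe_le_norm (q (x n))).trans ?_
      simp
  have hI : ∀ (G H : C(UnitAddTorus (Fin r), ℂ)), ‖I G - I H‖ ≤ ‖G - H‖ := fun G H => by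
    have h1 : I G - I H = ∫ y in Set.Icc (0 : Fin r → ℝ) 1, (G - H) (q y) :=
      (integral_sub (hint G) (hint H)).symm
    rw [h1]
    have hvol : (volume : Measure (Fin r → ℝ)).real (Set.Icc 0 1) = 1 := by
      simp [Measure.real, Real.volume_Icc_pi]
    have h2 := norm_setIntegral_le_of_norm_le_const (μ := volume) (s := Set.Icc (0 : Fin r → ℝ) 1)
      (f := fun y => (G - H) (q y)) (C := ‖G - H‖) isCompact_Icc.measure_lt_top
      fun y _ => (G - H).norm_coe_le_norm (q y)
    rwa [hvol, mul_one] at h2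
  have hFtend : Tendsto (avg F) atTop (nhds (I F)) := by
    rw [Metric.tendsto_atTop]
    intro ε hε
    have hFcl : F ∈ closure
        (Submodule.span ℂ (Set.range (UnitAddTorus.mFourier (d := Fin r))) : Set _) := by
      rw [← Submodule.topologicalClosure_coe, UnitAddTorus.span_mFourier_closure_eq_top]
      trivial
    obtain ⟨G, hG, hFG⟩ := Metric.mem_closure_iff.1 hFcl (ε / 3) (by linarith)
    obtain ⟨N₀, hN₀⟩ := Metric.tendsto_atTop.1 (hspan G hG) (ε / 3) (by linarith)
    refine ⟨N₀, fun N hN => ?_⟩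
    have h1 := havg F G N
    have h2 := hI G F
    have h3 := hN₀ N hN
    rw [dist_eq_norm] at hFG
    rw [norm_sub_rev G F] at h2
    rw [← dist_eq_norm] at h1 h2
    linarith [dist_triangle4 (avg F N) (avg G N) (I G) (I F)]
  simpa only [avg, I, q, hF] using hFtend

end

section
variable {r : ℕ}

lemma exists_vecMul_eq_smul_of_charpoly_isRoot {T : Matrix (Fin r) (Fin r) ℂ} {θ : ℂ}
    (hθ : T.charpoly.IsRoot θ) : ∃ x : Fin r → ℂ, x ≠ 0 ∧ ∀ n, x ᵥ* (T ^ n) = θ ^ n • x := by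
  rw [Polynomial.IsRoot.def, Matrix.eval_charpoly] at hθ
  obtain ⟨x, hx0, hx⟩ := Matrix.exists_vecMul_eq_zero_iff.2 hθ
  have h1 : x ᵥ* T = θ • x := by
    have hs : Matrix.scalar (Fin r) θ = θ • (1 : Matrix (Fin r) (Fin r) ℂ) := by
      rw [Matrix.smul_one_eq_diagonal, Matrix.scalar_apply]
    rw [Matrix.vecMul_sub, sub_eq_zero, hs, Matrix.vecMul_smul, Matrix.vecMul_one] at hx
    exact hx.symm
  refine ⟨x, hx0, fun n => ?_⟩
  induction n with
  | zero => simp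
  | succ n ih => rw [pow_succ, ← Matrix.vecMul_vecMul, ih, Matrix.smul_vecMul, h1, smul_smul,
      pow_succ]

lemma exists_int_mul_eq_intCast {ι : Type*} [Finite ι] (q : ι → ℚ) :
    ∃ D : ℤ, D ≠ 0 ∧ ∃ z : ι → ℤ, ∀ i, (D : ℚ) * q i = z i := by
  obtain ⟨D, hD⟩ := IsLocalization.exist_integer_multiples_of_finite (nonZeroDivisors ℤ) q
  choose z hz using hD
  refine ⟨D, nonZeroDivisors.coe_ne_zero D, z, fun i => ?_⟩
  have := hz i
  simp only [eq_intCast] at this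
  rw [this, zsmul_eq_mul]

/-- If a nonzero complex vector is orthogonal to a family of integer vectors, so is some nonzero
integer vector. -/
lemma exists_int_dotProduct_eq_zero (g : ℕ → Fin r → ℤ) {z : Fin r → ℂ} (hz : z ≠ 0)
    (hzg : ∀ n, z ⬝ᵥ (Int.castRingHom ℂ ∘ g n) = 0) :
    ∃ h : Fin r → ℤ, h ≠ 0 ∧ ∀ n, h ⬝ᵥ g n = 0 := by
  classical
  let W : Submodule ℚ (Fin r → ℚ) := Submodule.span ℚ (Set.range fun n i => (g n i : ℚ))
  have hW : W < ⊤ := by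
    rw [lt_top_iff_ne_top]
    intro htop
    have hker : ∀ y ∈ W, z ⬝ᵥ (fun i => (y i : ℂ)) = 0 := fun y hy => by
      induction hy using Submodule.span_induction with
      | mem y hy =>
        obtain ⟨n, rfl⟩ := hy
        refine Eq.trans ?_ (hzg n)
        simp [dotProduct]
      | zero => simp [dotProduct]
      | add a b _ _ ha hb =>
        have : (fun i => ((a + b) i : ℂ)) = (fun i => (a i : ℂ)) + fun i => (b i : ℂ) := by
          funext i; simp
        rw [this, dotProduct_add, ha, hb, add_zero]
      | smul t a _ ha =>
        have : (fun i => ((t • a) i : ℂ)) = (t : ℂ) • fun i => (a i : ℂ) := by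
          funext i; simp
        rw [this, dotProduct_smul, ha, smul_zero]
    apply hz
    funext j
    have h1 := hker (Pi.single j 1) (htop ▸ Submodule.mem_top)
    have h2 : (fun i => ((Pi.single j (1 : ℚ) : Fin r → ℚ) i : ℂ)) = Pi.single j 1 := by
      funext i
      by_cases hij : i = j
      · subst hij; simp
      · simp [hij]
    rw [h2, dotProduct_single, mul_one] at h1
    exact h1
  obtain ⟨φ, hφ0, hφ⟩ := Submodule.exists_le_ker_of_lt_top W hW
  obtain ⟨D, hD, h, hh⟩ := exists_int_mul_eq_intCast fun i => φ (Pi.single i 1)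
  have hDQ : (D : ℚ) ≠ 0 := by exact_mod_cast hD
  have hφapp : ∀ y : Fin r → ℚ, φ y = ∑ i, y i * φ (Pi.single i 1) := fun y => by
    conv_lhs => rw [pi_eq_sum_univ' y]
    simp [map_sum]
  refine ⟨h, ?_, fun n => ?_⟩
  · rintro rfl
    apply hφ0
    ext i
    have := hh i
    simp only [Pi.zero_apply, Int.cast_zero, mul_eq_zero, hDQ, false_or] at this
    simpa using this
  · have h0 : φ (fun i => (g n i : ℚ)) = 0 := hφ (Submodule.subset_span ⟨n, rfl⟩)
    rw [hφapp] at h0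
    have h1 : ((h ⬝ᵥ g n : ℤ) : ℚ) = 0 := by
      rw [dotProduct, Int.cast_sum, ← mul_zero (D : ℚ), ← h0, Finset.mul_sum]
      refine Finset.sum_congr rfl fun i _ => ?_
      rw [Int.cast_mul, ← hh i]
      ring
    exact_mod_cast h1

lemma not_udMod1_of_forall_sum_eq {x : ℕ → Fin r → ℝ} {h : Fin r → ℤ} (hh : h ≠ 0) {t : ℝ}
    (hx : ∀ n, ∑ i, h i * x n i = t) : ¬ UDMod1 x := fun hUD => by
  have h1 := hUD.tendsto_average_expTwoPi hh
  simp_rw [hx] at h1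
  have h2 : Tendsto (fun N : ℕ => (N : ℂ)⁻¹ • ∑ n ∈ Finset.range N, expTwoPi t) atTop
      (nhds (expTwoPi t)) := by
    refine tendsto_const_nhds.congr' ?_
    filter_upwards [eventually_ge_atTop 1] with N hN
    have : (N : ℂ) ≠ 0 := by exact_mod_cast (by omega : N ≠ 0)
    simp [this]
  have h3 := norm_expTwoPi t
  rw [tendsto_nhds_unique h2 h1, norm_zero] at h3
  exact zero_ne_one h3

lemma sum_mul_pow_mulVec_smul (B : Matrix (Fin r) (Fin r) ℤ) (h m : Fin r → ℤ) {c : Fin r → ℝ}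
    {D : ℤ} (hD : D ≠ 0) (hm : ∀ i, (D : ℝ) * c i = m i) (n : ℕ) (ω : ℝ) :
    ∑ i, (h i : ℝ) * ((B.map (Int.cast : ℤ → ℝ)) ^ n *ᵥ (ω • c)) i =
      (h ⬝ᵥ (B ^ n *ᵥ m) : ℤ) * ((D : ℝ)⁻¹ * ω) := by
  have hDR : (D : ℝ) ≠ 0 := by exact_mod_cast hD
  have hc : ω • c = ((D : ℝ)⁻¹ * ω) • (Int.castRingHom ℝ ∘ m) := by
    funext i
    simp only [Pi.smul_apply, smul_eq_mul, Function.comp_apply, eq_intCast, ← hm i]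
    field_simp
  have hpow : (B.map (Int.cast : ℤ → ℝ)) ^ n = (B ^ n).map (Int.castRingHom ℝ) :=
    (map_pow (Int.castRingHom ℝ).mapMatrix B n).symm
  rw [hc, hpow, Matrix.mulVec_smul, dotProduct, Int.cast_sum, Finset.sum_mul]
  refine Finset.sum_congr rfl fun i _ => ?_
  have := RingHom.map_mulVec (Int.castRingHom ℝ) (B ^ n) m i
  rw [Pi.smul_apply, smul_eq_mul, ← this, Int.cast_mul, eq_intCast]
  ring

lemma ae_udMod1_pow_mulVec_smul {B : Matrix (Fin r) (Fin r) ℤ} {m : Fin r → ℤ} {c : Fin r → ℝ}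
    {D : ℤ} (hD : D ≠ 0) (hm : ∀ i, (D : ℝ) * c i = m i)
    (hmult : ∀ h : Fin r → ℤ, h ≠ 0 → ∃ K : ℕ, ∀ (C : ℤ) (S : Finset ℕ),
      (∀ n ∈ S, h ⬝ᵥ (B ^ n *ᵥ m) = C) → S.card ≤ K) {k : ℕ} (hk : 1 ≤ k) (ℓ : ℕ) :
    ∀ᵐ ω ∂(volume : Measure ℝ),
      UDMod1 fun n => (B.map (Int.cast : ℤ → ℝ)) ^ (k * n + ℓ) *ᵥ (ω • c) := by
  classical
  have hDR : (D : ℝ) ≠ 0 := by exact_mod_cast hD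
  have hall : ∀ᵐ ω ∂(volume : Measure ℝ), ∀ h : Fin r → ℤ, h ≠ 0 →
      Tendsto (fun N : ℕ => (N : ℂ)⁻¹ • ∑ n ∈ Finset.range N,
        expTwoPi ((h ⬝ᵥ (B ^ (k * n + ℓ) *ᵥ m) : ℤ) * ((D : ℝ)⁻¹ * ω))) atTop (nhds 0) := by
    rw [ae_all_iff]
    intro h
    by_cases hh : h = 0
    · simp [hh]
    obtain ⟨K, hK⟩ := hmult h hh
    have hinj : Function.Injective fun n => k * n + ℓ := fun a b hab => by
      have : k * a = k * b := by simpa using hab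
      exact Nat.eq_of_mul_eq_mul_left hk this
    have hae := ae_tendsto_average_expTwoPi (u := fun n => h ⬝ᵥ (B ^ (k * n + ℓ) *ᵥ m)) (K := K)
      fun C S hS => by
        rw [← Finset.card_image_of_injective S hinj]
        refine hK C _ fun n hn => ?_
        obtain ⟨a, ha, rfl⟩ := Finset.mem_image.1 hn
        exact hS a ha
    have hqmp : Measure.QuasiMeasurePreserving (fun ω : ℝ => (D : ℝ)⁻¹ * ω) volume volume := by
      refine ⟨measurable_const_mul _, ?_⟩
      rw [Real.map_volume_mul_left (inv_ne_zero hDR)]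
      exact Measure.smul_absolutelyContinuous
    filter_upwards [hqmp.ae hae] with ω hω _ using hω
  filter_upwards [hall] with ω hω
  refine udMod1_of_tendsto_average_expTwoPi fun h hh => ?_
  simp_rw [sum_mul_pow_mulVec_smul B h m hD hm]
  exact hω h hh

/-- An eigenvalue of `B` that is a root of unity obstructs uniform distribution. -/
lemma not_udMod1_of_isRoot_of_pow_eq_one {B : Matrix (Fin r) (Fin r) ℤ} {m : Fin r → ℤ}
    {c : Fin r → ℝ} {D : ℤ} (hD : D ≠ 0) (hm : ∀ i, (D : ℝ) * c i = m i) {θ : ℂ}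
    (hθ : ((Int.castRingHom ℂ).mapMatrix B).charpoly.IsRoot θ) {k : ℕ} (hθk : θ ^ k = 1) (ω : ℝ) :
    ¬ UDMod1 fun n => (B.map (Int.cast : ℤ → ℝ)) ^ (k * n + 0) *ᵥ (ω • c) := by
  obtain ⟨x, hx0, hx⟩ := exists_vecMul_eq_smul_of_charpoly_isRoot hθ
  have hdetC : ((Int.castRingHom ℂ).mapMatrix (B ^ k - 1)).det = 0 :=
    Matrix.exists_vecMul_eq_zero_iff.1 ⟨x, hx0, by
      rw [map_sub, map_pow, map_one, Matrix.vecMul_sub, hx, hθk, one_smul, Matrix.vecMul_one,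
        sub_self]⟩
  rw [← RingHom.map_det] at hdetC
  have hdet : (B ^ k - 1).det = 0 := Int.cast_eq_zero.1 hdetC
  obtain ⟨h, hh, hhB⟩ := Matrix.exists_vecMul_eq_zero_iff.2 hdet
  rw [Matrix.vecMul_sub, Matrix.vecMul_one, sub_eq_zero] at hhB
  have hpow : ∀ n, h ᵥ* B ^ (k * n) = h := fun n => by
    induction n with
    | zero => simp
    | succ n ih => rw [mul_add, mul_one, pow_add, ← Matrix.vecMul_vecMul, ih, hhB]
  refine not_udMod1_of_forall_sum_eq hh (t := (h ⬝ᵥ m : ℤ) * ((D : ℝ)⁻¹ * ω)) fun n => ?_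
  rw [sum_mul_pow_mulVec_smul B h m hD hm, add_zero, Matrix.dotProduct_mulVec, hpow]

/-- Two distinct eigenvalues of `B` with equal `k`-th powers obstruct uniform distribution. -/
lemma not_udMod1_of_isRoot_of_pow_eq_pow {B : Matrix (Fin r) (Fin r) ℤ} {m : Fin r → ℤ}
    {c : Fin r → ℝ} {D : ℤ} (hD : D ≠ 0) (hm : ∀ i, (D : ℝ) * c i = m i)
    (hcyc : ∀ x : Fin r → ℂ, (∀ n, x ⬝ᵥ (((Int.castRingHom ℂ).mapMatrix B) ^ n *ᵥ
      (Int.castRingHom ℂ ∘ m)) = 0) → x = 0) {θ η : ℂ}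
    (hθ : ((Int.castRingHom ℂ).mapMatrix B).charpoly.IsRoot θ)
    (hη : ((Int.castRingHom ℂ).mapMatrix B).charpoly.IsRoot η) (hne : θ ≠ η) {k : ℕ}
    (hpow : θ ^ k = η ^ k) (ω : ℝ) :
    ¬ UDMod1 fun n => (B.map (Int.cast : ℤ → ℝ)) ^ (k * n + 0) *ᵥ (ω • c) := by
  set T := (Int.castRingHom ℂ).mapMatrix B with hT
  set mc : Fin r → ℂ := Int.castRingHom ℂ ∘ m with hmc
  obtain ⟨x, hx0, hx⟩ := exists_vecMul_eq_smul_of_charpoly_isRoot hθ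
  obtain ⟨y, hy0, hy⟩ := exists_vecMul_eq_smul_of_charpoly_isRoot hη
  have hym : y ⬝ᵥ mc ≠ 0 := fun h0 => hy0 <| hcyc y fun n => by
    rw [Matrix.dotProduct_mulVec, hy, smul_dotProduct, h0, smul_zero]
  have hz : (y ⬝ᵥ mc) • x - (x ⬝ᵥ mc) • y ≠ 0 := fun h0 => by
    rw [sub_eq_zero] at h0
    have h1 := congrArg (fun v => v ᵥ* T ^ 1) h0
    simp only [Matrix.smul_vecMul] at h1
    rw [hx, hy, pow_one, pow_one] at h1
    rw [smul_comm (x ⬝ᵥ mc) η, ← h0, smul_comm _ θ, ← sub_eq_zero, ← sub_smul] at h1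
    rcases smul_eq_zero.1 h1 with h2 | h2
    · exact hne (sub_eq_zero.1 h2)
    · exact (smul_ne_zero hym hx0) h2
  obtain ⟨h, hh, hhB⟩ := exists_int_dotProduct_eq_zero (fun n => B ^ (k * n) *ᵥ m) hz fun n => by
    have h1 : Int.castRingHom ℂ ∘ (B ^ (k * n) *ᵥ m) = T ^ (k * n) *ᵥ mc := by
      funext i
      rw [hT, ← map_pow]
      exact RingHom.map_mulVec _ _ _ _
    rw [h1, Matrix.dotProduct_mulVec, Matrix.sub_vecMul, Matrix.smul_vecMul, Matrix.smul_vecMul,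
      hx, hy, pow_mul, pow_mul, hpow]
    simp only [sub_dotProduct, smul_dotProduct, smul_eq_mul]
    ring
  refine not_udMod1_of_forall_sum_eq hh (t := 0) fun n => ?_
  rw [sum_mul_pow_mulVec_smul B h m hD hm, add_zero, hhB, Int.cast_zero, zero_mul]

end

section
variable {d r : ℕ}

/-- The coordinate vector of `v` is cyclic for the matrix of `A` on the span of the orbit of `v`. -/
lemma mem_span_pow_mulVec_of_span_eq {A : Matrix (Fin d) (Fin d) ℝ} {v : Fin d → ℝ}
    {b : Fin r → Fin d → ℝ} (hbli : LinearIndependent ℝ b)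
    (hbspan : Submodule.span ℝ (Set.range b) ≤
      Submodule.span ℝ (Set.range fun i : Fin d => (A ^ (i : ℕ)) *ᵥ v))
    {B : Matrix (Fin r) (Fin r) ℝ} (hB : ∀ j, A *ᵥ b j = ∑ i, B i j • b i)
    {c : Fin r → ℝ} (hc : v = ∑ j, c j • b j) (y : Fin r → ℝ) :
    y ∈ Submodule.span ℝ (Set.range fun n : ℕ => (B ^ n) *ᵥ c) := by
  let L : (Fin r → ℝ) →ₗ[ℝ] (Fin d → ℝ) := Fintype.linearCombination ℝ b
  have hLapp : ∀ y, L y = ∑ j, y j • b j := fun y => Fintype.linearCombination_apply ℝ b y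
  have hLinj : Function.Injective L := hbli.fintypeLinearCombination_injective
  have hLB : ∀ y, A *ᵥ L y = L (B *ᵥ y) := fun y => by
    rw [hLapp, hLapp, Matrix.mulVec_sum]
    simp_rw [Matrix.mulVec_smul, hB, Finset.smul_sum, Matrix.mulVec, dotProduct, Finset.sum_smul]
    rw [Finset.sum_comm]
    refine Finset.sum_congr rfl fun i _ => Finset.sum_congr rfl fun j _ => ?_
    rw [smul_smul, mul_comm]
  have hLpow : ∀ n : ℕ, A ^ n *ᵥ v = L (B ^ n *ᵥ c) := fun n => by
    induction n with
    | zero => simp [hLapp, hc]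
    | succ n ih => rw [pow_succ', ← Matrix.mulVec_mulVec, ih, hLB, Matrix.mulVec_mulVec, pow_succ']
  have hLy : L y ∈ Submodule.span ℝ (Set.range b) := by
    rw [hLapp]
    exact Submodule.sum_mem _ fun j _ =>
      Submodule.smul_mem _ _ (Submodule.subset_span ⟨j, rfl⟩)
  have hle : Submodule.span ℝ (Set.range fun i : Fin d => (A ^ (i : ℕ)) *ᵥ v) ≤
      (Submodule.span ℝ (Set.range fun n : ℕ => (B ^ n) *ᵥ c)).map L := by
    rw [Submodule.span_le]
    rintro _ ⟨i, rfl⟩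
    exact ⟨_, Submodule.subset_span ⟨(i : ℕ), rfl⟩, (hLpow i).symm⟩
  obtain ⟨y', hy', hyy⟩ := hle (hbspan hLy)
  rwa [← hLinj hyy]

lemma eq_zero_of_forall_dotProduct_pow_mulVec {B : Matrix (Fin r) (Fin r) ℤ} {m : Fin r → ℤ}
    {c : Fin r → ℝ} {D : ℤ} (hm : ∀ i, (D : ℝ) * c i = m i)
    (hspan : ∀ y : Fin r → ℝ, y ∈ Submodule.span ℝ
      (Set.range fun n : ℕ => ((B.map (Int.cast : ℤ → ℝ)) ^ n) *ᵥ c)) (hD : D ≠ 0)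
    (x : Fin r → ℂ) (hx : ∀ n, x ⬝ᵥ (((Int.castRingHom ℂ).mapMatrix B) ^ n *ᵥ
      (Int.castRingHom ℂ ∘ m)) = 0) : x = 0 := by
  classical
  have hDC : (D : ℂ) ≠ 0 := by exact_mod_cast hD
  have hker : ∀ y : Fin r → ℝ, x ⬝ᵥ (Complex.ofRealHom ∘ y) = 0 := fun y => by
    induction hspan y using Submodule.span_induction with
    | mem y hy =>
      obtain ⟨n, rfl⟩ := hy
      have h1 : (Int.castRingHom ℂ ∘ m) = (D : ℂ) • (Complex.ofRealHom ∘ c) := by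
        funext i
        have : ((m i : ℝ) : ℂ) = ((D : ℝ) * c i : ℝ) := by rw [hm i]
        simpa using this
      have h2 : Complex.ofRealHom ∘ (((B.map (Int.cast : ℤ → ℝ)) ^ n) *ᵥ c) =
          ((Int.castRingHom ℂ).mapMatrix B) ^ n *ᵥ (Complex.ofRealHom ∘ c) := by
        have h3 : (Int.castRingHom ℂ).mapMatrix B =
            Complex.ofRealHom.mapMatrix (B.map (Int.cast : ℤ → ℝ)) := by
          ext i j
          simp
        funext i
        rw [h3, ← map_pow]
        exact RingHom.map_mulVec _ _ _ _
      have h4 := hx n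
      rw [h1, Matrix.mulVec_smul, dotProduct_smul, ← h2] at h4
      exact (smul_eq_zero.1 h4).resolve_left hDC
    | zero => simp [dotProduct]
    | add a b _ _ ha hb =>
      have : Complex.ofRealHom ∘ (a + b) = Complex.ofRealHom ∘ a + Complex.ofRealHom ∘ b := by
        funext i; simp
      rw [this, dotProduct_add, ha, hb, add_zero]
    | smul t a _ ha =>
      have : Complex.ofRealHom ∘ (t • a) = (t : ℂ) • (Complex.ofRealHom ∘ a) := by
        funext i; simp
      rw [this, dotProduct_smul, ha, smul_zero]
  funext j
  have h1 := hker (Pi.single j 1)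
  have h2 : Complex.ofRealHom ∘ (Pi.single j (1 : ℝ) : Fin r → ℝ) = Pi.single j 1 := by
    funext i
    by_cases hij : i = j
    · subst hij; simp
    · simp [hij]
  rw [h2, dotProduct_single, mul_one] at h1
  exact h1

end

theorem stmt12 (d : ℕ) (A : Matrix (Fin d) (Fin d) ℤ) (v : Fin d → ℚ) (hv : v ≠ 0)
    -- `𝓑 = (b 0, …, b (r-1))` is a lattice basis of `V = Span_ℝ{v, Av, …, A^{d-1}v}`
    (r : ℕ) (b : Fin r → (Fin d → ℝ))
    (hbint : ∀ j i, ∃ z : ℤ, b j i = (z : ℝ))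
    (hbli : LinearIndependent ℝ b)
    (hbspan : Submodule.span ℝ (Set.range b) = Submodule.span ℝ (Set.range
      (fun i : Fin d => ((A.map (Int.cast : ℤ → ℝ)) ^ (i : ℕ)) *ᵥ fun j => ((v j : ℝ)))))
    (hlat : ∀ x ∈ Submodule.span ℝ (Set.range b), (∀ i, ∃ z : ℤ, x i = (z : ℝ)) →
      ∃ c : Fin r → ℤ, x = ∑ j : Fin r, ((c j : ℝ)) • b j)
    -- `B` is the (integer) matrix of `A|_V` in the basis `𝓑`
    (B : Matrix (Fin r) (Fin r) ℤ)
    (hB : ∀ j, (A.map (Int.cast : ℤ → ℝ)) *ᵥ b j = ∑ i : Fin r, ((B i j : ℝ)) • b i)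
    -- `A|_V` is non-singular
    (hns : B.det ≠ 0)
    -- `c` is the coordinate vector of `v` in the basis `𝓑`, so that `φ_𝓑(A^m ω v) = B^m (ω c)`
    (c : Fin r → ℝ) (hc : (fun j => ((v j : ℝ))) = ∑ j : Fin r, c j • b j) :
    (∀ (k : ℕ), 1 ≤ k → ∀ (ℓ : ℕ), ∀ᵐ ω ∂(volume : Measure ℝ),
        UDMod1 (fun n => ((B.map (Int.cast : ℤ → ℝ)) ^ (k * n + ℓ)) *ᵥ (ω • c))) ↔
      ((¬ ∃ θ η : ℂ, ((B.charpoly).map (Int.castRingHom ℂ)).IsRoot θ ∧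
          ((B.charpoly).map (Int.castRingHom ℂ)).IsRoot η ∧ θ ≠ η ∧ IsRootOfUnity (θ / η)) ∧
        ¬ ∃ θ : ℂ, ((B.charpoly).map (Int.castRingHom ℂ)).IsRoot θ ∧ IsRootOfUnity θ) := by
  classical
  obtain ⟨D, hD, w, hw⟩ := exists_int_mul_eq_intCast v
  have hw' : ∀ i, (D : ℝ) * (v i : ℝ) = w i := fun i => by
    exact_mod_cast congrArg (Rat.cast : ℚ → ℝ) (hw i)
  have hDv : (D : ℝ) • (fun j => (v j : ℝ)) ∈ Submodule.span ℝ (Set.range b) := by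
    rw [hc]
    exact Submodule.smul_mem _ _ (Submodule.sum_mem _ fun j _ =>
      Submodule.smul_mem _ _ (Submodule.subset_span ⟨j, rfl⟩))
  obtain ⟨m, hm⟩ := hlat _ hDv fun i => ⟨w i, hw' i⟩
  have hm' : ∀ i, (D : ℝ) * c i = m i := by
    rw [hc, Finset.smul_sum] at hm
    simp_rw [smul_smul] at hm
    exact fun i => congrFun (hbli.fintypeLinearCombination_injective
      (a₁ := fun i => (D : ℝ) * c i) (a₂ := fun i => (m i : ℝ))
      (by simpa only [Fintype.linearCombination_apply] using hm)) i
  have hcyc := eq_zero_of_forall_dotProduct_pow_mulVec hm'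
    (mem_span_pow_mulVec_of_span_eq hbli hbspan.le hB hc) hD
  have hchar : (B.charpoly).map (Int.castRingHom ℂ) =
      ((Int.castRingHom ℂ).mapMatrix B).charpoly := (Matrix.charpoly_map B _).symm
  rw [hchar]
  have hT : ((Int.castRingHom ℂ).mapMatrix B).det ≠ 0 := by
    rw [← RingHom.map_det]
    exact fun h0 => hns (Int.cast_eq_zero.1 h0)
  constructor
  · refine fun hUD => ⟨?_, ?_⟩
    · rintro ⟨θ, η, hθ, hη, hne, k, hk, hpow⟩
      rw [div_pow, div_eq_one_iff_eq (pow_ne_zero _ (ne_zero_of_charpoly_isRoot hT hη))] at hpow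
      obtain ⟨ω, hω⟩ := (hUD k hk 0).exists
      exact not_udMod1_of_isRoot_of_pow_eq_pow hD hm' hcyc hθ hη hne hpow ω hω
    · rintro ⟨θ, hθ, k, hk, hpow⟩
      obtain ⟨ω, hω⟩ := (hUD k hk 0).exists
      exact not_udMod1_of_isRoot_of_pow_eq_one hD hm' hθ hpow ω hω
  · rintro ⟨hratio, hone⟩ k hk ℓ
    refine ae_udMod1_pow_mulVec_smul hD hm' (fun h hh => ?_) hk ℓ
    refine exists_card_le_of_dotProduct_pow_eq hns hcyc (fun M hM z w hz hw hpow => ?_)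
      (fun M hM z hz hpow => hone ⟨z, hz, M, hM, hpow⟩) hh
    by_contra hne
    refine hratio ⟨z, w, hz, hw, hne, M, hM, ?_⟩
    rw [div_pow, hpow, div_self (pow_ne_zero _ (ne_zero_of_charpoly_isRoot hT hw))]
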